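/- arXiv:1511.04893 — 6 statements merged into one kernel-verified Lean document; each statement's English description precedes it below -/
import Mathlib

section
/- Let G = (N, C, P, S) be a ZCFGr and let H = (N, C ⊎ C̃, P', S) where C̃ = { c̃ : c ∈ C } is a disjoint copy of C and P' contains the production (a, R ∪ R̃, (z, −z), w) for every production (a, R, z, w) ∈ P (here R̃ = { c̃ : c ∈ R } and (z, −z) ∈ ℤ^{C ⊎ C̃} has value z(c) on c and −z(c) on c̃). Then for all multisets s, t over N and all u, v ∈ ℤ^C: (s, u) →* (t, v) in G if and only if (s, (u, −u)) →* (t, (v, −v)) in H. -/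
open scoped Classical

/-- A production of a context-free commutative grammar with integer counters and
resets (ZCFGr): `(a_p, R_p, z_p, w_p)`. -/
structure Production (N C : Type) where
  lhs : N
  resets : Set C
  update : C → ℤ
  rhs : Multiset N

/-- A configuration: a finite multiset over non-terminals together with a counter
valuation in `ℤ^C`. -/
abbrev Config (N C : Type) := Multiset N × (C → ℤ)

/-- `resetOn u R` is `u_{|R}`: it agrees with `u` outside `R` and is `0` on `R`. -/
noncomputable def resetOn {C : Type} (u : C → ℤ) (R : Set C) : C → ℤ :=
  fun c => if c ∈ R then 0 else u c

/-- Elementary step using the production `p`. -/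
def StepP {N C : Type} (p : Production N C) : Config N C → Config N C → Prop :=
  fun cfg cfg' => ∃ w : Multiset N,
    cfg.1 = w + {p.lhs} ∧ cfg'.1 = w + p.rhs ∧
    cfg'.2 = resetOn cfg.2 p.resets + p.update

/-- Elementary step using any production from `P`. -/
def Step {N C : Type} (P : Set (Production N C)) : Config N C → Config N C → Prop :=
  fun cfg cfg' => ∃ p ∈ P, StepP p cfg cfg'

/-- Reachability: reflexive-transitive closure of the step relation. -/
def Reach {N C : Type} (P : Set (Production N C)) : Config N C → Config N C → Prop :=
  Relation.ReflTransGen (Step P)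

/-- The production `(a, R ∪ R̃, (z, -z), w)` over the doubled counter set `C ⊎ C̃`
obtained from a production `(a, R, z, w)` over `C`.  The left summand of `C ⊕ C`
plays the role of `C` and the right summand the role of the disjoint copy `C̃`. -/
def liftProd {N C : Type} (p : Production N C) : Production N (C ⊕ C) :=
  { lhs := p.lhs
    resets := {x | ∃ c ∈ p.resets, x = Sum.inl c ∨ x = Sum.inr c}
    update := Sum.elim p.update (fun c => - p.update c)
    rhs := p.rhs }

/-- The counter valuation `(u, -u)` on the doubled counter set. -/
def doubled {C : Type} (u : C → ℤ) : C ⊕ C → ℤ :=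
  Sum.elim u (fun c => - u c)

lemma resetOn_doubled_add_update {N C : Type} (p : Production N C) (u : C → ℤ) :
    resetOn (doubled u) (liftProd p).resets + (liftProd p).update =
      doubled (resetOn u p.resets + p.update) := by
  funext x
  rcases x with c | c <;> by_cases hc : c ∈ p.resets <;>
    simp [resetOn, doubled, liftProd, hc, add_comm]

lemma resetOn_liftProd_comp_inl {N C : Type} (p : Production N C) (u : C ⊕ C → ℤ) :
    (resetOn u (liftProd p).resets + (liftProd p).update) ∘ Sum.inl =
      resetOn (u ∘ Sum.inl) p.resets + p.update := by
  funext c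
  by_cases hc : c ∈ p.resets <;> simp [resetOn, liftProd, hc]

lemma Step.doubled {N C : Type} {P : Set (Production N C)} {x y : Config N C}
    (h : Step P x y) :
    Step (liftProd '' P) (x.1, _root_.doubled x.2) (y.1, _root_.doubled y.2) := by
  obtain ⟨p, hp, w, hx, hy, hu⟩ := h
  refine ⟨liftProd p, ⟨p, hp, rfl⟩, w, hx, hy, ?_⟩
  rw [hu]
  exact (resetOn_doubled_add_update p x.2).symm

lemma Step.comp_inl {N C : Type} {P : Set (Production N C)} {x y : Config N (C ⊕ C)}
    (h : Step (liftProd '' P) x y) :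
    Step P (x.1, x.2 ∘ Sum.inl) (y.1, y.2 ∘ Sum.inl) := by
  obtain ⟨_, ⟨p, hp, rfl⟩, w, hx, hy, hu⟩ := h
  refine ⟨p, hp, w, hx, hy, ?_⟩
  rw [hu]
  exact resetOn_liftProd_comp_inl p x.2

/-- `(s, u) →* (t, v)` in `G = (N, C, P, S)` iff
`(s, (u, -u)) →* (t, (v, -v))` in `H = (N, C ⊎ C̃, P', S)`, where `P'` consists of
the productions `(a, R ∪ R̃, (z, -z), w)` for `(a, R, z, w) ∈ P`. -/
theorem reach_iff_reach_doubled {N C : Type} [Fintype N] [Fintype C]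
    (P : Set (Production N C)) (hP : P.Finite) (S : N)
    (s t : Multiset N) (u v : C → ℤ) :
    Reach P (s, u) (t, v) ↔
      Reach (liftProd '' P) (s, Sum.elim u (fun c => - u c))
        (t, Sum.elim v (fun c => - v c)) := by
  constructor
  · exact Relation.ReflTransGen.lift (fun x : Config N C => (x.1, doubled x.2))
      (fun _ _ => Step.doubled) _ _
  · exact Relation.ReflTransGen.lift
      (fun x : Config N (C ⊕ C) => (x.1, x.2 ∘ Sum.inl)) (fun _ _ => Step.comp_inl) _ _
end

section
/- Let Σ be a finite alphabet and γ ∈ Σ⁺ a nonempty word. If γ = γ₁ a₁ γ₂ a₂ ⋯ γ_ℓ a_ℓ and γ = γ'₁ b₁ γ'₂ b₂ ⋯ γ'_{ℓ'} b_{ℓ'} are two decompositions such that a₁, …, a_ℓ are pairwise distinct, b₁, …, b_{ℓ'} are pairwise distinct, each γ_j uses only letters from {a_j, …, a_ℓ}, and each γ'_j uses only letters from {b_j, …, b_{ℓ'}}, then ℓ = ℓ', a_j = b_j for all j, and γ_j = γ'_j for all j. -/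
/-- `IsLastOccDecomp γ g a` says that the nonempty word `γ` decomposes as
`γ = γ₁ a₁ γ₂ a₂ ⋯ γ_ℓ a_ℓ` where (0-indexed) `g = [γ₁, …, γ_ℓ]` and
`a = [a₁, …, a_ℓ]`, the letters `a₁, …, a_ℓ` are pairwise distinct, and each
`γ_j` uses only letters from `{a_j, a_{j+1}, …, a_ℓ}` (i.e. from `a.drop j`,
0-indexed `j`). -/
def IsLastOccDecomp {α : Type} (γ : List α) (g : List (List α)) (a : List α) : Prop :=
  a ≠ [] ∧ g.length = a.length ∧ a.Nodup ∧
  γ = (List.zipWith (fun gj aj => gj ++ [aj]) g a).flatten ∧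
  ∀ (j : ℕ) (hj : j < g.length), ∀ x ∈ g.get ⟨j, hj⟩, x ∈ a.drop j

/-- The tail of a decomposition satisfies the same letter constraints. -/
theorem forall_mem_drop_of_cons {α : Type} {u : List α} {g : List (List α)} {b : α} {a : List α}
    (h : ∀ (j : ℕ) (hj : j < (u :: g).length), ∀ x ∈ (u :: g).get ⟨j, hj⟩, x ∈ (b :: a).drop j) :
    ∀ (j : ℕ) (hj : j < g.length), ∀ x ∈ g.get ⟨j, hj⟩, x ∈ a.drop j :=
  fun j hj x hx => h (j + 1) (Nat.succ_lt_succ hj) x hx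

/-- The letters occurring in a decomposed word are exactly the distinguished letters. -/
theorem mem_flatten_zipWith_iff {α : Type} (g : List (List α)) (a : List α)
    (hlen : g.length = a.length)
    (h : ∀ (j : ℕ) (hj : j < g.length), ∀ x ∈ g.get ⟨j, hj⟩, x ∈ a.drop j) (x : α) :
    x ∈ (List.zipWith (fun gj aj => gj ++ [aj]) g a).flatten ↔ x ∈ a := by
  induction g generalizing a with
  | nil =>
    obtain rfl := List.length_eq_zero_iff.mp hlen.symm
    simp
  | cons u g ih =>
    cases a with
    | nil => simp at hlen
    | cons b a =>
      have hu : x ∈ u → x ∈ b :: a := fun hx => h 0 (Nat.succ_pos _) x hx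
      have hrec := ih a (by simpa using hlen) (forall_mem_drop_of_cons h)
      simp only [List.zipWith_cons_cons, List.flatten_cons, List.mem_append, hrec,
        List.mem_cons] at hu ⊢
      tauto

/-- If `p ++ x :: s` and `p ++ t ++ x' :: s'` both split the same word at its first letter that
does not reoccur later, then `t` is empty. -/
theorem eq_nil_of_cons_eq_append_cons {α : Type} {p s t s' : List α} {x x' : α}
    (e : x :: s = t ++ x' :: s') (hx : x ∉ s)
    (h : ∀ y ∈ p ++ t, y ∈ x' :: s') : t = [] := by
  cases t with
  | nil => rfl
  | cons z t =>
    obtain ⟨rfl, rfl⟩ := List.cons.inj e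
    exact absurd (List.mem_append_right t (h x (by simp))) hx

/-- A word splits in at most one way at its first letter that does not reoccur later. -/
theorem append_cons_inj_of_last_occurrence {α : Type} {p p' s s' : List α} {x x' : α}
    (e : p ++ x :: s = p' ++ x' :: s') (hx : x ∉ s) (hx' : x' ∉ s')
    (h : ∀ y ∈ p, y ∈ x :: s) (h' : ∀ y ∈ p', y ∈ x' :: s') :
    p = p' ∧ x = x' ∧ s = s' := by
  rcases List.append_eq_append_iff.mp e with ⟨t, rfl, ht⟩ | ⟨t, rfl, ht⟩
  · obtain rfl := eq_nil_of_cons_eq_append_cons ht hx h'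
    simpa using ht
  · obtain rfl := eq_nil_of_cons_eq_append_cons ht hx' h
    simpa [eq_comm] using ht

/-- Uniqueness of decompositions, including the empty one. -/
theorem eq_of_flatten_zipWith_eq {α : Type} (g g' : List (List α)) (a a' : List α)
    (hlen : g.length = a.length) (hlen' : g'.length = a'.length)
    (hnd : a.Nodup) (hnd' : a'.Nodup)
    (h : ∀ (j : ℕ) (hj : j < g.length), ∀ x ∈ g.get ⟨j, hj⟩, x ∈ a.drop j)
    (h' : ∀ (j : ℕ) (hj : j < g'.length), ∀ x ∈ g'.get ⟨j, hj⟩, x ∈ a'.drop j)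
    (e : (List.zipWith (fun gj aj => gj ++ [aj]) g a).flatten =
      (List.zipWith (fun gj aj => gj ++ [aj]) g' a').flatten) :
    g = g' ∧ a = a' := by
  induction g generalizing a g' a' with
  | nil =>
    obtain rfl := List.length_eq_zero_iff.mp hlen.symm
    cases g' <;> cases a' <;> simp_all
  | cons u g ih =>
    cases a with
    | nil => simp at hlen
    | cons b a =>
      cases g' with
      | nil => simp at e
      | cons u' g' =>
        cases a' with
        | nil => simp at hlen'
        | cons b' a' =>
          have hl : g.length = a.length := by simpa using hlen
          have hl' : g'.length = a'.length := by simpa using hlen'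
          have ht := forall_mem_drop_of_cons h
          have ht' := forall_mem_drop_of_cons h'
          have hm := mem_flatten_zipWith_iff g a hl ht
          have hm' := mem_flatten_zipWith_iff g' a' hl' ht'
          rw [List.nodup_cons] at hnd hnd'
          simp only [List.zipWith_cons_cons, List.flatten_cons, List.append_assoc,
            List.singleton_append] at e
          obtain ⟨rfl, rfl, es⟩ := append_cons_inj_of_last_occurrence e
            (by rw [hm]; exact hnd.1) (by rw [hm']; exact hnd'.1)
            (fun y hy => by
              rw [List.mem_cons, hm, ← List.mem_cons]; exact h 0 (Nat.succ_pos _) y hy)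
            (fun y hy => by
              rw [List.mem_cons, hm', ← List.mem_cons]; exact h' 0 (Nat.succ_pos _) y hy)
          obtain ⟨rfl, rfl⟩ := ih g' a a' hl hl' hnd.2 hnd'.2 ht ht' es
          exact ⟨rfl, rfl⟩

/-- the decomposition `γ = γ₁ a₁ γ₂ a₂ ⋯ γ_ℓ a_ℓ` of a nonempty word
with pairwise distinct `a_j` and each `γ_j` using only letters among
`a_j, …, a_ℓ` is unique: the lengths agree, the `a_j` agree and the `γ_j` agree. -/
theorem lastOccDecomp_unique {α : Type} [Fintype α] (γ : List α) (hγ : γ ≠ [])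
    (g g' : List (List α)) (a a' : List α)
    (h : IsLastOccDecomp γ g a) (h' : IsLastOccDecomp γ g' a') :
    g = g' ∧ a = a' := by
  obtain ⟨-, hlen, hnd, rfl, hmem⟩ := h
  obtain ⟨-, hlen', hnd', e, hmem'⟩ := h'
  exact eq_of_flatten_zipWith_eq g g' a a' hlen hlen' hnd hnd' hmem hmem' e
end

section
/- Let G = (N, C, P, S) be a ZCFGr with P = {p₁, …, p_k}, let (s, u) and (t, v) be configurations, and let γ ∈ P⁺ be a nonempty run with (s, u) →_γ (t, v). Suppose γ decomposes as γ = γ_m p_{σ(m)} γ_{m+1} p_{σ(m+1)} ⋯ γ_k p_{σ(k)} where σ is a permutation of {1, …, k}, 1 ≤ m ≤ k, and for each i ∈ {m, …, k} the word γ_i uses only productions from {p_{σ(i)}, …, p_{σ(k)}}. For i ∈ {m, …, k} let α_i ∈ ℕ^P be the Parikh image of γ_i (α_i(p) is the number of occurrences of p in γ_i), let R_i = R_{p_{σ(i)}} ∪ ⋯ ∪ R_{p_{σ(k)}} ⊆ C, and set R_{k+1} = ∅. Then v = u_{|R_m} + Σ_{i=m}^{k} [ ( Σ_{p ∈ P}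 α_i(p) · z_p )_{|R_i} + ( z_{p_{σ(i)}} )_{|R_{i+1}} ]. -/
open scoped Classical

/-- `RunList l c c'` : the sequence of productions `l` forms a run from
configuration `c` to configuration `c'`. -/
def RunList {N C : Type} : List (Production N C) → Config N C → Config N C → Prop
  | [], c, c' => c = c'
  | p :: rest, c, c'' => ∃ c', StepP p c c' ∧ RunList rest c' c''

/-- `Rbig prods σ i` is the set `R_i = R_{p_{σ(i)}} ∪ ⋯ ∪ R_{p_{σ(k)}}`
(0-indexed: the union of reset sets of the productions `p_{σ(i')}` for
`i ≤ i' ≤ k - 1`); in particular `Rbig prods σ k = ∅`. -/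
def Rbig {N C : Type} {k : ℕ} (prods : Fin k → Production N C)
    (σ : Equiv.Perm (Fin k)) (i : ℕ) : Set C :=
  {c | ∃ i' : Fin k, i ≤ (i' : ℕ) ∧ c ∈ (prods (σ i')).resets}

theorem RunList.append {N C : Type} {l₁ l₂ : List (Production N C)} {a b : Config N C}
    (h : RunList (l₁ ++ l₂) a b) : ∃ c, RunList l₁ a c ∧ RunList l₂ c b := by
  induction l₁ generalizing a with
  | nil => exact ⟨a, rfl, h⟩
  | cons p l ih =>
    obtain ⟨a', hstep, hrest⟩ := h
    obtain ⟨c, hl, hl₂⟩ := ih hrest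
    exact ⟨c, ⟨a', hstep, hl⟩, hl₂⟩

theorem StepP.counter_eq {N C : Type} {p : Production N C} {a b : Config N C}
    (h : StepP p a b) (c : C) :
    b.2 c = (if c ∈ p.resets then 0 else a.2 c) + p.update c := by
  obtain ⟨_, _, _, h⟩ := h
  rw [h]
  rfl

/-- A run that never resets the counter `c` adds to it the total update given by the
Parikh image of the run. -/
theorem RunList.counter_eq_of_notMem_resets {N C : Type} {k : ℕ}
    {prods : Fin k → Production N C} {l : List (Fin k)} {a b : Config N C} {c : C}
    (h : RunList (l.map prods) a b) (hc : ∀ j ∈ l, c ∉ (prods j).resets) :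
    b.2 c = a.2 c + ∑ p : Fin k, (l.count p : ℤ) * (prods p).update c := by
  induction l generalizing a with
  | nil =>
    obtain rfl : a = b := h
    simp
  | cons j l ih =>
    obtain ⟨a', hstep, hrest⟩ := h
    rw [ih hrest fun i hi => hc i (List.mem_cons_of_mem _ hi), hstep.counter_eq,
      if_neg (hc j List.mem_cons_self)]
    simp [List.count_cons, add_mul, Finset.sum_add_distrib]
    ring

theorem mem_Rbig_iff {N C : Type} {k : ℕ} (prods : Fin k → Production N C)
    (σ : Equiv.Perm (Fin k)) {n : ℕ} (hn : n < k) (c : C) :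
    c ∈ Rbig prods σ n ↔ c ∈ (prods (σ ⟨n, hn⟩)).resets ∨ c ∈ Rbig prods σ (n + 1) := by
  constructor
  · rintro ⟨i, hi, hc⟩
    rcases hi.eq_or_lt with rfl | hlt
    · exact Or.inl hc
    · exact Or.inr ⟨i, hlt, hc⟩
  · rintro (hc | ⟨i, hi, hc⟩)
    · exact ⟨⟨n, hn⟩, le_rfl, hc⟩
    · exact ⟨i, Nat.le_of_succ_le hi, hc⟩

/-- The effect on one counter of the part of a decomposed run that starts at position `n`. -/
theorem RunList.counter_eq_of_decomposition {N C : Type} {k : ℕ}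
    (prods : Fin k → Production N C) (σ : Equiv.Perm (Fin k)) (g : Fin k → List (Fin k))
    (c : C) {n : ℕ} (hn : n ≤ k)
    (hg : ∀ i : Fin k, n ≤ (i : ℕ) → ∀ j ∈ g i, ∃ i' : Fin k, i ≤ i' ∧ j = σ i')
    {a b : Config N C}
    (hrun : RunList ((((List.finRange k).drop n).flatMap (fun i => g i ++ [σ i])).map prods)
      a b) :
    b.2 c = resetOn a.2 (Rbig prods σ n) c
      + ∑ i ∈ Finset.univ.filter (fun i : Fin k => n ≤ (i : ℕ)),
          (resetOn (fun c => ∑ p : Fin k, ((g i).count p : ℤ) * (prods p).update c)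
              (Rbig prods σ (i : ℕ)) c
            + resetOn ((prods (σ i)).update) (Rbig prods σ ((i : ℕ) + 1)) c) := by
  induction hn using Nat.decreasingInduction generalizing a with
  | self =>
    rw [List.drop_of_length_le (by simp)] at hrun
    obtain rfl : a = b := hrun
    have hR : c ∉ Rbig prods σ k := fun ⟨i, hi, _⟩ => absurd i.isLt (not_lt.mpr hi)
    rw [Finset.filter_false_of_mem fun i _ => not_le.mpr i.isLt]
    simp [resetOn, hR]
  | of_succ n hn ih =>
    rw [List.drop_eq_getElem_cons (by simpa using hn), List.getElem_finRange,
      List.flatMap_cons, List.map_append, List.map_append] at hrun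
    obtain ⟨a₂, hhead, htail⟩ := hrun.append
    obtain ⟨a₁, hfree, a₂', hstep, rfl⟩ := hhead.append
    have hfilter : Finset.univ.filter (fun i : Fin k => n ≤ (i : ℕ))
        = insert ⟨n, hn⟩ (Finset.univ.filter (fun i : Fin k => n + 1 ≤ (i : ℕ))) := by
      ext i
      simp only [Finset.mem_filter, Finset.mem_univ, true_and, Finset.mem_insert, Fin.ext_iff]
      omega
    rw [ih (fun i hi => hg i (Nat.le_of_succ_le hi)) htail, hfilter,
      Finset.sum_insert (by simp), ← add_assoc]
    congr 1
    have hR := mem_Rbig_iff prods σ hn c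
    by_cases hlater : c ∈ Rbig prods σ (n + 1)
    · simp [resetOn, hlater, hR]
    by_cases hnow : c ∈ Rbig prods σ n
    · have hreset := (hR.mp hnow).resolve_right hlater
      simpa [resetOn, hlater, hnow, hreset] using hstep.counter_eq c
    · have hreset : c ∉ (prods (σ ⟨n, hn⟩)).resets := fun h => hnow (hR.mpr (Or.inl h))
      have hcount := hfree.counter_eq_of_notMem_resets (c := c) (by
        intro j hj hmem
        obtain ⟨i', hi', rfl⟩ := hg _ le_rfl j hj
        exact hnow ⟨i', hi', hmem⟩)
      have hlast := hstep.counter_eq c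
      simp only [Fin.cast_mk] at hlast hcount
      rw [if_neg hreset, hcount] at hlast
      simp only [resetOn, hlater, hnow, if_false]
      rw [hlast]
      ring

/-- if a nonempty run `γ` from `(s, u)` to `(t, v)` decomposes as
`γ = γ_m p_{σ(m)} γ_{m+1} p_{σ(m+1)} ⋯ γ_k p_{σ(k)}` (0-indexed here: `i` ranges
over `m ≤ i ≤ k - 1`), where `σ` is a permutation of the production indices and
each partial run `γ_i` (given by the list of indices `g i`) uses only
productions among `p_{σ(i)}, …, p_{σ(k)}`, then, with `α_i(p)` the number of
occurrences of `p` in `γ_i` and `R_i = R_{p_{σ(i)}} ∪ ⋯ ∪ R_{p_{σ(k)}}`,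
`v = u_{|R_m} + Σ_{i=m}^{k} [ (Σ_{p ∈ P} α_i(p)·z_p)_{|R_i} + (z_{p_{σ(i)}})_{|R_{i+1}} ]`. -/
theorem effect_of_generalized_parikh {N C : Type} [Fintype N] [Fintype C] {k : ℕ}
    (hk : 1 ≤ k) (prods : Fin k → Production N C) (hinj : Function.Injective prods)
    (σ : Equiv.Perm (Fin k)) (m : Fin k)
    (g : Fin k → List (Fin k))
    (hg : ∀ i : Fin k, m ≤ i → ∀ j ∈ g i, ∃ i' : Fin k, i ≤ i' ∧ j = σ i')
    (s t : Multiset N) (u v : C → ℤ)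
    (hrun : RunList
      (((((List.finRange k).drop (m : ℕ)).flatMap (fun i => g i ++ [σ i])).map prods))
      (s, u) (t, v)) :
    v = resetOn u (Rbig prods σ (m : ℕ))
        + ∑ i ∈ Finset.univ.filter (fun i : Fin k => m ≤ i),
            (resetOn
              (fun c => ∑ p : Fin k, ((g i).count p : ℤ) * (prods p).update c)
              (Rbig prods σ (i : ℕ))
             + resetOn ((prods (σ i)).update) (Rbig prods σ ((i : ℕ) + 1))) := by
  funext c
  simpa using RunList.counter_eq_of_decomposition prods σ g c m.isLt.le hg hrun
end

section
/- Let r, s ≥ 1, let u₁, …, u_r ∈ ℕ, v₁, …, v_s ∈ ℕ, and t ∈ ℕ. Set h = (Σ_{j=1}^{r} u_j) + (Σ_{j=1}^{s} v_j) + 1 and assume t < h. Then for every i ∈ ℕ with i < 2^r, the following are equivalent: (1) there exist ε ∈ {0,1}^r and δ ∈ {0,1}^s such that Σ_{j=1}^{r} ε_j · (u_j + 2^{j−1}·h) + Σ_{j=1}^{s} δ_j · v_j = t + i·h; (2) there exists δ ∈ {0,1}^s such that Σ_{j=1}^{r} bit_{j−1}(i) · u_j + Σ_{j=1}^{s} δ_j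 · v_j = t, where bit_{j−1}(i) ∈ {0,1} is the coefficient of 2^{j−1} in the binary expansion of i. -/
theorem Nat.ofBits_eq_sum {n : ℕ} (f : Fin n → Bool) :
    Nat.ofBits f = ∑ j, (f j).toNat * 2 ^ (j : ℕ) := by
  induction n with
  | zero => simp
  | succ n ih =>
    rw [Nat.ofBits_succ, ih, Fin.sum_univ_succ, Finset.mul_sum, add_comm]
    simp [pow_succ, mul_comm, mul_left_comm]

theorem sum_testBit_mul_two_pow {r i : ℕ} (hi : i < 2 ^ r) :
    ∑ j : Fin r, (if i.testBit (j : ℕ) then 1 else 0) * 2 ^ (j : ℕ) = i := by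
  have h := Nat.ofBits_testBit i r
  rw [Nat.mod_eq_of_lt hi, Nat.ofBits_eq_sum] at h
  simpa only [Bool.toNat, Bool.cond_eq_ite] using h

/-- Uniqueness of binary digits. -/
theorem eq_testBit_of_sum_mul_two_pow {r i : ℕ} {ε : Fin r → ℕ} (hε : ∀ j, ε j ≤ 1)
    (h : ∑ j, ε j * 2 ^ (j : ℕ) = i) (j : Fin r) :
    ε j = if i.testBit (j : ℕ) then 1 else 0 := by
  have hbits : Nat.ofBits (fun j => decide (ε j = 1)) = i := by
    rw [Nat.ofBits_eq_sum, ← h]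
    refine Finset.sum_congr rfl fun j _ => ?_
    rcases Nat.le_one_iff_eq_zero_or_eq_one.mp (hε j) with h0 | h1 <;> simp [*]
  rw [← hbits, Nat.testBit_ofBits_lt _ _ j.isLt]
  rcases Nat.le_one_iff_eq_zero_or_eq_one.mp (hε j) with h0 | h1 <;> simp [*]

theorem sum_mul_le_sum_of_le_one {ι : Type*} [Fintype ι] {ε : ι → ℕ} (hε : ∀ j, ε j ≤ 1)
    (w : ι → ℕ) : ∑ j, ε j * w j ≤ ∑ j, w j :=
  Finset.sum_le_sum fun j _ => by simpa using Nat.mul_le_mul_right (w j) (hε j)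

theorem sum_mul_add_two_pow_mul {r : ℕ} (ε u : Fin r → ℕ) (h : ℕ) :
    ∑ j, ε j * (u j + 2 ^ (j : ℕ) * h) =
      ∑ j, ε j * u j + (∑ j, ε j * 2 ^ (j : ℕ)) * h := by
  simp only [mul_add, Finset.sum_add_distrib, Finset.sum_mul, mul_assoc]

/-- correctness of the reduction from Π₂-Subset Sum to
Simultaneous Subset Sum, instance-wise.  With `h = Σu + Σv + 1`, `t < h` and
`i < 2^r`, a `{0,1}`-combination of the numbers `u_j + 2^{j-1}·h` and `v_j`
sums to `t + i·h` iff the subset of the `u_j` selected by the binary digits of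
`i`, together with some subset of the `v_j`, sums to `t`.  (Indices are
0-based: `u_j` carries the weight `2^j·h` and `bit_j(i)` is the coefficient of
`2^j` in the binary expansion of `i`.) -/
theorem simultaneous_subset_sum_reduction {r s : ℕ} (hr : 1 ≤ r) (hs : 1 ≤ s)
    (u : Fin r → ℕ) (v : Fin s → ℕ) (t h : ℕ)
    (hh : h = (∑ j, u j) + (∑ j, v j) + 1) (ht : t < h)
    (i : ℕ) (hi : i < 2 ^ r) :
    (∃ (ε : Fin r → ℕ) (δ : Fin s → ℕ),
        (∀ j, ε j ≤ 1) ∧ (∀ j, δ j ≤ 1) ∧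
        (∑ j, ε j * (u j + 2 ^ (j : ℕ) * h)) + (∑ j, δ j * v j) = t + i * h) ↔
    (∃ δ : Fin s → ℕ, (∀ j, δ j ≤ 1) ∧
        (∑ j : Fin r, (if i.testBit (j : ℕ) then 1 else 0) * u j)
          + (∑ j, δ j * v j) = t) := by
  constructor
  · rintro ⟨ε, δ, hε, hδ, hsum⟩
    rw [sum_mul_add_two_pow_mul, add_right_comm] at hsum
    have hu := sum_mul_le_sum_of_le_one hε u
    have hv := sum_mul_le_sum_of_le_one hδ v
    have hlt : ∑ j, ε j * u j + ∑ j, δ j * v j < h := by omega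
    have hdigits : ∑ j, ε j * 2 ^ (j : ℕ) = i := by
      have hdiv := congrArg (· / h) hsum
      simpa [Nat.add_mul_div_right _ _ (Nat.zero_lt_of_lt ht), Nat.div_eq_of_lt hlt,
        Nat.div_eq_of_lt ht] using hdiv
    refine ⟨δ, hδ, ?_⟩
    simp only [← eq_testBit_of_sum_mul_two_pow hε hdigits]
    rw [hdigits] at hsum
    exact Nat.add_right_cancel hsum
  · rintro ⟨δ, hδ, hsum⟩
    refine ⟨fun j => if i.testBit (j : ℕ) then 1 else 0, δ, fun j => ?_, hδ, ?_⟩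
    · dsimp only
      split_ifs <;> simp
    · rw [sum_mul_add_two_pow_mul, sum_testBit_mul_two_pow hi, add_right_comm, hsum]
end

section
/- For m ≥ 1 and d ≥ 1 let E_m^d ∈ ℤ^{(d·m)×(d·(m−1))} be the block-diagonal matrix with d diagonal blocks each equal to D_m, where D_m ∈ ℤ^{m×(m−1)} has entries d_{i,i} = 1, d_{i+1,i} = −2 and 0 elsewhere, and let R : ℤ^{d·m} → ℤ^d be the linear map that applies r(y) = Σ_{j=0}^{m−1} y^{(j)}·2^j to each of the d consecutive blocks of m coordinates. Then for every y ∈ ℤ^{d·m}: R(y) = 0 if and only if there exists z ∈ ℤ^{d·(m−1)} with E_m^d·z = y. -/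
/-- The block-diagonal matrix `E_m^d ∈ ℤ^{(d·m)×(d·(m-1))}` with `d` diagonal
blocks each equal to `D_m`, where `D_m ∈ ℤ^{m×(m-1)}` has entries `d_{i,i} = 1`,
`d_{i+1,i} = -2` and `0` elsewhere.  Row index `i` belongs to block `i / m` with
in-block position `i % m`; column index `j` belongs to block `j / (m-1)` with
in-block position `j % (m-1)`. -/
def Emat (d m : ℕ) : Matrix (Fin (d * m)) (Fin (d * (m - 1))) ℤ := fun i j =>
  if (i : ℕ) / m = (j : ℕ) / (m - 1) ∧ (i : ℕ) % m = (j : ℕ) % (m - 1) then 1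
  else if (i : ℕ) / m = (j : ℕ) / (m - 1) ∧ (i : ℕ) % m = (j : ℕ) % (m - 1) + 1 then -2
  else 0

/-- The linear map `R : ℤ^{d·m} → ℤ^d` applying `r(y) = Σ_{j=0}^{m-1} y^{(j)}·2^j`
to each of the `d` consecutive blocks of `m` coordinates: block `b` consists of
the coordinates `i` with `i / m = b`, and within a block, written
`(y^{(m-1)}, …, y^{(0)})`, the coordinate at in-block position `i % m` carries
the weight `2^{m-1-(i % m)}`. -/
def Rmap (d m : ℕ) (y : Fin (d * m) → ℤ) : Fin d → ℤ := fun b =>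
  ∑ i : Fin (d * m),
    if (i : ℕ) / m = (b : ℕ) then y i * 2 ^ (m - 1 - (i : ℕ) % m) else 0

/-- `R` read block by block. -/
theorem Rmap_succ_apply {d k : ℕ} (y : Fin (d * (k + 1)) → ℤ) (b : Fin d) :
    Rmap d (k + 1) y b
      = ∑ p : Fin (k + 1), y (finProdFinEquiv (b, p)) * 2 ^ (k - (p : ℕ)) := by
  unfold Rmap
  rw [← finProdFinEquiv.sum_comp, Fintype.sum_prod_type, Finset.sum_eq_single b]
  · refine Finset.sum_congr rfl fun p _ => ?_
    simp [finProdFinEquiv_apply_val, Nat.add_mul_div_left, Nat.div_eq_of_lt p.2,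
      Nat.mod_eq_of_lt p.2]
  · intro c _ hc
    refine Finset.sum_eq_zero fun p _ => ?_
    simp [finProdFinEquiv_apply_val, Nat.add_mul_div_left, Nat.div_eq_of_lt p.2,
      Fin.val_inj, hc]
  · simp

/-- Multiplication by `E` read block by block: on each block `z` it is
`(z, 0) - 2 (0, z)`. -/
theorem Emat_succ_mulVec {d k : ℕ} (z : Fin (d * k) → ℤ) (b : Fin d) (p : Fin (k + 1)) :
    (Emat d (k + 1)).mulVec z (finProdFinEquiv (b, p))
      = Fin.snoc (α := fun _ => ℤ) (fun q : Fin k => z (finProdFinEquiv (b, q))) 0 p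
        - 2 * Fin.cons (α := fun _ => ℤ) 0 (fun q : Fin k => z (finProdFinEquiv (b, q))) p := by
  have hentry : ∀ (c : Fin d) (q : Fin k),
      Emat d (k + 1) (finProdFinEquiv (b, p)) (finProdFinEquiv (c, q))
        = if b = c then (if p = q.castSucc then 1 else 0) - 2 * (if p = q.succ then 1 else 0)
          else 0 := by
    intro c q
    have hk : 0 < k := q.pos
    simp only [Emat, finProdFinEquiv_apply_val, Nat.add_sub_cancel,
      Nat.add_mul_div_left _ _ hk, Nat.add_mul_div_left _ _ k.succ_pos,
      Nat.div_eq_of_lt p.2, Nat.div_eq_of_lt q.2, Nat.add_mul_mod_self_left,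
      Nat.mod_eq_of_lt p.2, Nat.mod_eq_of_lt q.2, Fin.ext_iff, Fin.val_castSucc, Fin.val_succ,
      zero_add]
    split_ifs <;> omega
  have hsum : (Emat d (k + 1)).mulVec z (finProdFinEquiv (b, p))
      = ∑ q : Fin k, ((if p = q.castSucc then 1 else 0) - 2 * (if p = q.succ then 1 else 0))
          * z (finProdFinEquiv (b, q)) := by
    change ∑ j : Fin (d * k), Emat d (k + 1) (finProdFinEquiv (b, p)) j * z j = _
    rw [← finProdFinEquiv.sum_comp, Fintype.sum_prod_type, Finset.sum_eq_single b]
    · exact Finset.sum_congr rfl fun q _ => by rw [hentry, if_pos rfl]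
    · intro c _ hc
      exact Finset.sum_eq_zero fun q _ => by rw [hentry, if_neg hc.symm, zero_mul]
    · simp
  rw [hsum]
  simp only [sub_mul, mul_assoc, Finset.sum_sub_distrib, ← Finset.mul_sum, ite_mul, one_mul,
    zero_mul]
  congr 1
  · induction p using Fin.lastCases with
    | last => simp [(Fin.castSucc_ne_last _).symm]
    | cast p => simp
  · congr 1
    induction p using Fin.cases with
    | zero => simp [(Fin.succ_ne_zero _).symm]
    | succ p => simp

theorem sum_snoc_sub_two_mul_cons {k : ℕ} (z : Fin k → ℤ) :
    ∑ p : Fin (k + 1), (Fin.snoc (α := fun _ => ℤ) z 0 p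
      - 2 * Fin.cons (α := fun _ => ℤ) 0 z p) * 2 ^ (k - (p : ℕ)) = 0 := by
  simp only [sub_mul, Finset.sum_sub_distrib]
  rw [Fin.sum_univ_castSucc, Fin.sum_univ_succ (fun p => 2 * _ * _), sub_eq_zero]
  simp only [Fin.snoc_castSucc, Fin.snoc_last, Fin.cons_zero, Fin.cons_succ, Fin.val_castSucc,
    Fin.val_succ, zero_mul, mul_zero, add_zero, zero_add]
  refine Finset.sum_congr rfl fun q _ => ?_
  rw [show k - (q : ℕ) = k - (q + 1) + 1 by omega, pow_succ]
  ring

/-- Horner's scheme: the partial evaluations `z` of `y` at `2` satisfy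
`(z, r(y)) - 2 (0, z) = y`. -/
theorem exists_snoc_sub_two_mul_cons {k : ℕ} (y : Fin (k + 1) → ℤ) :
    ∃ z : Fin k → ℤ, ∀ p : Fin (k + 1),
      Fin.snoc (α := fun _ => ℤ) z (∑ q : Fin (k + 1), y q * 2 ^ (k - (q : ℕ))) p
        - 2 * Fin.cons (α := fun _ => ℤ) 0 z p = y p := by
  induction k with
  | zero =>
    refine ⟨Fin.elim0, fun p => ?_⟩
    obtain rfl : p = 0 := Fin.fin_one_eq_zero p
    simp [Fin.snoc]
  | succ k ih =>
    obtain ⟨z, hz⟩ := ih fun q => y q.castSucc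
    refine ⟨Fin.snoc (α := fun _ => ℤ) z
      (∑ q : Fin (k + 1), y q.castSucc * 2 ^ (k - (q : ℕ))), fun p => ?_⟩
    rw [Fin.cons_snoc_eq_snoc_cons]
    induction p using Fin.lastCases with
    | last =>
      rw [Fin.snoc_last, Fin.snoc_last, Fin.sum_univ_castSucc, Finset.mul_sum]
      have hpow : ∀ q : Fin (k + 1), y q.castSucc * 2 ^ (k + 1 - (q.castSucc : ℕ))
          = 2 * (y q.castSucc * 2 ^ (k - (q : ℕ))) := fun q => by
        rw [Fin.val_castSucc, show k + 1 - (q : ℕ) = k - q + 1 by omega, pow_succ]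
        ring
      simp only [hpow]
      simp
    | cast p => simpa only [Fin.snoc_castSucc] using hz p

/-- the image of `E_m^d` equals the kernel of `R`: for
`y ∈ ℤ^{d·m}`, `R(y) = 0` iff `y = E_m^d·z` for some `z ∈ ℤ^{d·(m-1)}`. -/
theorem image_Emat_eq_ker_Rmap {d m : ℕ} (hd : 1 ≤ d) (hm : 1 ≤ m)
    (y : Fin (d * m) → ℤ) :
    (∀ b : Fin d, Rmap d m y b = 0) ↔
      ∃ z : Fin (d * (m - 1)) → ℤ, (Emat d m).mulVec z = y := by
  obtain ⟨k, rfl⟩ : ∃ k, m = k + 1 := ⟨m - 1, by omega⟩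
  constructor
  · intro h
    have hblock : ∀ b : Fin d, ∃ z : Fin k → ℤ, ∀ p : Fin (k + 1),
        Fin.snoc (α := fun _ => ℤ) z 0 p - 2 * Fin.cons (α := fun _ => ℤ) 0 z p
          = y (finProdFinEquiv (b, p)) := fun b => by
      obtain ⟨z, hz⟩ := exists_snoc_sub_two_mul_cons (fun p => y (finProdFinEquiv (b, p)))
      refine ⟨z, ?_⟩
      rwa [← Rmap_succ_apply, h b] at hz
    choose z hz using hblock
    refine ⟨fun j => z (finProdFinEquiv.symm j).1 (finProdFinEquiv.symm j).2, ?_⟩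
    funext i
    obtain ⟨⟨b, p⟩, rfl⟩ := finProdFinEquiv.surjective i
    rw [Emat_succ_mulVec, ← hz]
    simp
  · rintro ⟨z, rfl⟩ b
    rw [Rmap_succ_apply]
    simp only [Emat_succ_mulVec]
    exact sum_snoc_sub_two_mul_cons _
end

section
/- Let d, r, s, m ≥ 1, let A ∈ ℤ^{d×r}, B ∈ ℤ^{d×s}, v ∈ ℤ^d, and let R : ℤ^{d·m} → ℤ^d be the linear map applying r(y) = Σ_{j=0}^{m−1} y^{(j)}·2^j blockwise to each of the d consecutive blocks of m coordinates. Suppose A' ∈ ℤ^{(d·m)×r}, B₀ ∈ ℤ^{(d·m)×s}, and v' ∈ ℤ^{d·m} satisfy R(A'·x) = A·x for all x ∈ ℤ^r, R(B₀·y) = B·y for all y ∈ ℤ^s, and R(v') = v. Let E = E_m^d ∈ ℤ^{(d·m)×(d·(m−1))} be the block-diagonal matrix with d blocks D_m. Then the following are equivalent: (1) for every x ∈ ℕ^r there exists y ∈ ℕ^s with A·x + B·y = v; (2) for every x ∈ ℕ^r there exist y ∈ ℕ^s and z₁, z₂ ∈ ℕ^{d·(m−1)} with A'·x + B₀·y +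 E·z₁ − E·z₂ = v'. -/
/-- On indices written as (block, position) pairs, `Rmap` is a weighted sum over one block. -/
lemma Rmap_apply_finProdFinEquiv (d n : ℕ) (y : Fin (d * (n + 1)) → ℤ) (b : Fin d) :
    Rmap d (n + 1) y b =
      ∑ p : Fin (n + 1), y (finProdFinEquiv (b, p)) * 2 ^ (n - (p : ℕ)) := by
  unfold Rmap
  rw [← finProdFinEquiv.sum_comp, Fintype.sum_prod_type, Finset.sum_eq_single b]
  · refine Finset.sum_congr rfl fun p _ => ?_
    simp [Nat.add_mul_div_left, Nat.div_eq_of_lt p.2, Nat.mod_eq_of_lt p.2]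
  · intro c _ hc
    refine Finset.sum_eq_zero fun p _ => if_neg ?_
    simpa [Nat.add_mul_div_left, Nat.div_eq_of_lt p.2, Fin.ext_iff] using hc
  · simp

lemma Emat_finProdFinEquiv (d n : ℕ) (b c : Fin d) (p : Fin (n + 1)) (q : Fin n) :
    Emat d (n + 1) (finProdFinEquiv (b, p)) (finProdFinEquiv (c, q)) =
      if b = c then (if p = q.castSucc then 1 else 0) - 2 * (if p = q.succ then 1 else 0)
      else 0 := by
  have hn : 0 < n := q.pos
  have hdiv : ((q : ℕ) + n * c) / n = c := by
    rw [Nat.add_mul_div_left _ _ hn, Nat.div_eq_of_lt q.2, zero_add]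
  have hmod : ((q : ℕ) + n * c) % n = q := by
    rw [Nat.add_mul_mod_self_left, Nat.mod_eq_of_lt q.2]
  have hdiv' : ((p : ℕ) + (n + 1) * b) / (n + 1) = b := by
    rw [Nat.add_mul_div_left _ _ n.succ_pos, Nat.div_eq_of_lt p.2, zero_add]
  have hmod' : ((p : ℕ) + (n + 1) * b) % (n + 1) = p := by
    rw [Nat.add_mul_mod_self_left, Nat.mod_eq_of_lt p.2]
  simp only [Emat, finProdFinEquiv_apply_val, Nat.add_sub_cancel, hdiv, hmod, hdiv', hmod',
    Fin.ext_iff, Fin.val_castSucc, Fin.val_succ]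
  split_ifs <;> omega

/-- Each block of `E z` is the difference `(z, 0) - 2 (0, z)` of two shifts of the block of `z`. -/
lemma Emat_mulVec_finProdFinEquiv (d n : ℕ) (z : Fin (d * n) → ℤ) (b : Fin d) (p : Fin (n + 1)) :
    (Emat d (n + 1)).mulVec z (finProdFinEquiv (b, p)) =
      (Fin.snoc (fun q => z (finProdFinEquiv (b, q))) 0 : Fin (n + 1) → ℤ) p
        - 2 * (Fin.cons 0 (fun q => z (finProdFinEquiv (b, q))) : Fin (n + 1) → ℤ) p := by
  have hsnoc : ∀ u : Fin n → ℤ, (Fin.snoc u 0 : Fin (n + 1) → ℤ) p =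
      ∑ q, if p = q.castSucc then u q else 0 := by
    intro u
    induction p using Fin.lastCases with
    | last => simp [(Fin.castSucc_lt_last _).ne']
    | cast p => simp
  have hcons : ∀ u : Fin n → ℤ, (Fin.cons 0 u : Fin (n + 1) → ℤ) p =
      ∑ q, if p = q.succ then u q else 0 := by
    intro u
    induction p using Fin.cases with
    | zero => simp [(Fin.succ_ne_zero _).symm]
    | succ p => simp
  rw [hsnoc, hcons, Finset.mul_sum, ← Finset.sum_sub_distrib]
  change ∑ j : Fin (d * n), Emat d (n + 1) (finProdFinEquiv (b, p)) j * z j = _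
  rw [← finProdFinEquiv.sum_comp, Fintype.sum_prod_type, Finset.sum_eq_single b]
  · refine Finset.sum_congr rfl fun q _ => ?_
    rw [Emat_finProdFinEquiv, if_pos rfl]
    split_ifs <;> ring
  · intro c _ hc
    refine Finset.sum_eq_zero fun q _ => ?_
    rw [Emat_finProdFinEquiv, if_neg (Ne.symm hc), zero_mul]
  · simp

lemma Rmap_Emat_mulVec (d n : ℕ) (z : Fin (d * n) → ℤ) :
    Rmap d (n + 1) ((Emat d (n + 1)).mulVec z) = 0 := by
  funext b
  simp only [Rmap_apply_finProdFinEquiv, Emat_mulVec_finProdFinEquiv, sub_mul, mul_assoc,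
    Finset.sum_sub_distrib, ← Finset.mul_sum]
  rw [Fin.sum_univ_castSucc, Fin.sum_univ_succ (n := n)]
  simp only [Fin.snoc_castSucc, Fin.snoc_last, Fin.cons_zero, Fin.cons_succ, zero_mul, add_zero,
    zero_add, Fin.val_castSucc, Fin.val_succ, Finset.mul_sum, Pi.zero_apply]
  rw [sub_eq_zero]
  refine Finset.sum_congr rfl fun q _ => ?_
  have hq : n - (q : ℕ) = n - (q + 1) + 1 := by have := q.2; omega
  rw [hq, pow_succ]
  ring

/-- A block of binary value zero is a difference of shifts `(z, 0) - 2 (0, z)`; the entries of `z`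
are the partial Horner sums of the block. -/
lemma exists_snoc_sub_two_mul_cons_eq {n : ℕ} (w : Fin (n + 1) → ℤ)
    (hw : ∑ p : Fin (n + 1), w p * 2 ^ (n - (p : ℕ)) = 0) :
    ∃ z : Fin n → ℤ, ∀ p, (Fin.snoc z 0 : Fin (n + 1) → ℤ) p
      - 2 * (Fin.cons 0 z : Fin (n + 1) → ℤ) p = w p := by
  let W : ℕ → ℤ := fun k => if h : k < n + 1 then w ⟨k, h⟩ else 0
  let Z : ℕ → ℤ := fun k => ∑ j ∈ Finset.range k, W j * 2 ^ (k - 1 - j)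
  have hW : ∀ p : Fin (n + 1), W p = w p := fun p => dif_pos p.2
  have hZ : ∀ k, Z (k + 1) - 2 * Z k = W k := by
    intro k
    simp only [Z, Finset.sum_range_succ, Finset.mul_sum, Nat.add_sub_cancel, Nat.sub_self,
      pow_zero, mul_one]
    rw [sub_eq_iff_eq_add, add_comm, add_right_inj]
    refine Finset.sum_congr rfl fun j hj => ?_
    have hk : k - j = k - 1 - j + 1 := by have := Finset.mem_range.mp hj; omega
    rw [hk, pow_succ]
    ring
  have hlast : Z (n + 1) = 0 := by
    simp only [Z, Nat.add_sub_cancel, Finset.sum_range, hW, hw]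
  refine ⟨fun q => Z (q + 1), fun p => ?_⟩
  have hsnoc : (Fin.snoc (fun q : Fin n => Z (q + 1)) 0 : Fin (n + 1) → ℤ) p = Z (p + 1) := by
    induction p using Fin.lastCases with
    | last => simp [hlast]
    | cast p => simp
  have hcons : (Fin.cons 0 (fun q : Fin n => Z (q + 1)) : Fin (n + 1) → ℤ) p = Z p := by
    induction p using Fin.cases with
    | zero => simp [Z]
    | succ p => simp
  rw [hsnoc, hcons, hZ, hW]

lemma exists_Emat_mulVec_eq {d n : ℕ} (w : Fin (d * (n + 1)) → ℤ) (hw : Rmap d (n + 1) w = 0) :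
    ∃ z : Fin (d * n) → ℤ, (Emat d (n + 1)).mulVec z = w := by
  choose z hz using fun b => exists_snoc_sub_two_mul_cons_eq
    (fun p => w (finProdFinEquiv (b, p)))
    ((Rmap_apply_finProdFinEquiv d n w b).symm.trans (congrFun hw b))
  refine ⟨fun j => z (finProdFinEquiv.symm j).1 (finProdFinEquiv.symm j).2, ?_⟩
  funext i
  obtain ⟨⟨b, p⟩, rfl⟩ := finProdFinEquiv.surjective i
  rw [Emat_mulVec_finProdFinEquiv]
  simpa only [Equiv.symm_apply_apply] using hz b p

lemma Rmap_add (d m : ℕ) (y y' : Fin (d * m) → ℤ) :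
    Rmap d m (y + y') = Rmap d m y + Rmap d m y' := by
  funext b
  simp only [Rmap, Pi.add_apply, ← Finset.sum_add_distrib]
  exact Finset.sum_congr rfl fun i _ => by split_ifs <;> ring

lemma Rmap_sub (d m : ℕ) (y y' : Fin (d * m) → ℤ) :
    Rmap d m (y - y') = Rmap d m y - Rmap d m y' := by
  rw [eq_sub_iff_add_eq, ← Rmap_add, sub_add_cancel]

/-- correctness of the binary-expansion reduction for ZVAS
inclusion.  If `A' `, `B₀` and `v'` are blockwise binary expansions of `A`, `B`
and `v` (in the sense that `R(A'·x) = A·x`, `R(B₀·y) = B·y` and `R(v') = v`),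
and `E = E_m^d`, then the ∀∃-form of the inclusion instance `(A, B, v)` is
equivalent to that of the instance `(A', (B₀ | E | -E), v')`. -/
theorem zvas_inclusion_binary_reduction {d r s m : ℕ}
    (hd : 1 ≤ d) (hr : 1 ≤ r) (hs : 1 ≤ s) (hm : 1 ≤ m)
    (A : Matrix (Fin d) (Fin r) ℤ) (B : Matrix (Fin d) (Fin s) ℤ)
    (v : Fin d → ℤ)
    (A' : Matrix (Fin (d * m)) (Fin r) ℤ) (B₀ : Matrix (Fin (d * m)) (Fin s) ℤ)
    (v' : Fin (d * m) → ℤ)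
    (hA : ∀ x : Fin r → ℤ, Rmap d m (A'.mulVec x) = A.mulVec x)
    (hB : ∀ y : Fin s → ℤ, Rmap d m (B₀.mulVec y) = B.mulVec y)
    (hv : Rmap d m v' = v) :
    (∀ x : Fin r → ℕ, ∃ y : Fin s → ℕ,
        A.mulVec (fun j => (x j : ℤ)) + B.mulVec (fun j => (y j : ℤ)) = v) ↔
    (∀ x : Fin r → ℕ, ∃ (y : Fin s → ℕ) (z₁ z₂ : Fin (d * (m - 1)) → ℕ),
        A'.mulVec (fun j => (x j : ℤ)) + B₀.mulVec (fun j => (y j : ℤ))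
          + (Emat d m).mulVec (fun j => (z₁ j : ℤ))
          - (Emat d m).mulVec (fun j => (z₂ j : ℤ)) = v') := by
  obtain ⟨n, rfl⟩ : ∃ n, m = n + 1 := ⟨m - 1, by omega⟩
  refine forall_congr' fun x => exists_congr fun y => ⟨fun h => ?_, ?_⟩
  · obtain ⟨z, hz⟩ := exists_Emat_mulVec_eq
      (v' - (A'.mulVec (fun j => (x j : ℤ)) + B₀.mulVec (fun j => (y j : ℤ))))
      (by rw [Rmap_sub, Rmap_add, hA, hB, hv, h, sub_self])
    refine ⟨fun j => (z j).toNat, fun j => (-z j).toNat, ?_⟩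
    rw [add_sub_assoc, ← Matrix.mulVec_sub]
    have hsplit : ((fun j => ((z j).toNat : ℤ)) - fun j => ((-z j).toNat : ℤ)) = z :=
      funext fun j => Int.toNat_sub_toNat_neg (z j)
    exact (congrArg _ ((congrArg _ hsplit).trans hz)).trans (add_sub_cancel _ _)
  · rintro ⟨z₁, z₂, h⟩
    rw [← hv, ← h, Rmap_sub, Rmap_add, Rmap_add, hA, hB]
    erw [Rmap_Emat_mulVec, Rmap_Emat_mulVec]
    rw [add_zero, sub_zero]
end
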